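/- arXiv:1012.2943 — 2 statements merged into one kernel-verified Lean document; each statement's English description precedes it below -/
import Mathlib

section
/- Let a, c ∈ ℝ with 0 < a < c and b, d ∈ ℝ nonzero. Then as t → ±∞, the integral ∫_ℝ dx / (|x - at + ib|² |x - ct + id|²) is O(1/t²); i.e., there exist C > 0 and T > 0 such that for |t| ≥ T the integral is at most C/t². -/
open MeasureTheory

lemma aux_int (b : ℝ) (hb : b ≠ 0) : Integrable (fun x : ℝ => 1 / (x ^ 2 + b ^ 2)) := by
  have h := (integrable_inv_one_add_sq.comp_div hb).const_mul (1 / b ^ 2)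
  refine h.congr (Filter.Eventually.of_forall fun x => ?_)
  have h1 : 0 < b ^ 2 := by positivity
  have h2 : x ^ 2 + b ^ 2 ≠ 0 := by positivity
  have h3 : 1 + (x / b) ^ 2 ≠ 0 := by positivity
  have h4 : x ^ 2 + b ^ 2 = b ^ 2 * (1 + (x / b) ^ 2) := by
    field_simp
    ring
  simp only
  rw [h4, one_div, one_div, mul_inv]

/-- **Interaction integral estimate.** For `0 < a < c` and `b, d ≠ 0`,
`∫_ℝ dx/(|x-at+ib|²|x-ct+id|²) = O(1/t²)` as `t → ±∞`. -/
theorem stmt_6 (a c b d : ℝ) (ha : 0 < a) (hac : a < c) (hb : b ≠ 0) (hd : d ≠ 0) :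
    ∃ C > (0 : ℝ), ∃ T > (0 : ℝ), ∀ t : ℝ, T ≤ |t| →
      (∫ x : ℝ, 1 / (((x - a * t) ^ 2 + b ^ 2) * ((x - c * t) ^ 2 + d ^ 2)))
        ≤ C / t ^ 2 := by
  have hI : ∀ b : ℝ, 0 ≤ ∫ x : ℝ, 1 / (x ^ 2 + b ^ 2) := fun b =>
    integral_nonneg fun x => by positivity
  have hca : 0 < c - a := sub_pos.2 hac
  refine ⟨2 / (c - a) ^ 2 * ((∫ x : ℝ, 1 / (x ^ 2 + b ^ 2)) + ∫ x : ℝ, 1 / (x ^ 2 + d ^ 2)) + 1,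
    ?_, 1, one_pos, fun t ht => ?_⟩
  · have := hI b
    have := hI d
    positivity
  have ht0 : t ≠ 0 := by
    rintro rfl
    norm_num at ht
  have hB := (aux_int b hb).comp_sub_right (a * t)
  have hD := (aux_int d hd).comp_sub_right (c * t)
  have key : (∫ x : ℝ, 1 / (((x - a * t) ^ 2 + b ^ 2) * ((x - c * t) ^ 2 + d ^ 2))) ≤
      ∫ x : ℝ, 2 / (c - a) ^ 2 / t ^ 2 *
        (1 / ((x - a * t) ^ 2 + b ^ 2) + 1 / ((x - c * t) ^ 2 + d ^ 2)) := by
    refine integral_mono_of_nonneg (Filter.Eventually.of_forall fun x => ?_)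
      ((hB.add hD).const_mul _) (Filter.Eventually.of_forall fun x => ?_)
    · simp only [Pi.zero_apply]
      positivity
    · simp only
      have hP : 0 < (x - a * t) ^ 2 + b ^ 2 := by positivity
      have hQ : 0 < (x - c * t) ^ 2 + d ^ 2 := by positivity
      rw [div_add_div _ _ hP.ne' hQ.ne', div_div, div_mul_div_comm,
        div_le_div_iff₀ (by positivity) (by positivity)]
      have h : (c - a) ^ 2 * t ^ 2 ≤
          2 * (((x - a * t) ^ 2 + b ^ 2) + ((x - c * t) ^ 2 + d ^ 2)) := by
        nlinarith [sq_nonneg ((x - a * t) + (x - c * t)), sq_nonneg b, sq_nonneg d]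
      have := mul_le_mul_of_nonneg_right h (mul_pos hP hQ).le
      linarith
  refine key.trans ?_
  rw [integral_const_mul, integral_add hB hD,
    integral_sub_right_eq_self (fun x : ℝ => 1 / (x ^ 2 + b ^ 2)),
    integral_sub_right_eq_self (fun x : ℝ => 1 / (x ^ 2 + d ^ 2)), div_mul_eq_mul_div]
  gcongr
  linarith
end

section
/- With T(f) = x f - Λ(f) b_u on Ran(H_u) as above, the adjoint of T with respect to the L² inner product is T*(f) = x f - Λ(f), i.e., for all f₁, f₂ ∈ L²₊(ℝ): (T H_u f₁, H_u f₂) = (H_u f₁, x H_u f₂ - Λ(H_u f₂)). -/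
open MeasureTheory Complex Filter

def UH : Set ℂ := {z | 0 ≤ z.im}

def BB (r : ℂ → ℂ) : Prop := DifferentiableOn ℂ r UH ∧ ∃ C : ℝ, ∀ z ∈ UH, ‖r z‖ ≤ C

def EO (c : ℂ) (f : ℂ → ℂ) : Prop := ∃ r, BB r ∧ ∀ z ∈ UH, f z = c + (z + I)⁻¹ * r z

def EE (c : ℂ) (f : ℂ → ℂ) : Prop := ∃ e, EO c e ∧ ∀ z ∈ UH, f z = (z + I)⁻¹ * e z

lemma sub_ne {p z : ℂ} (hp : p.im < 0) (hz : z ∈ UH) : z - p ≠ 0 := by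
  intro h
  have := congrArg Complex.im h
  have hz' : 0 ≤ z.im := hz
  simp at this
  linarith

lemma BB.const (c : ℂ) : BB (fun _ => c) := ⟨differentiableOn_const c, ‖c‖, fun _ _ => le_rfl⟩

lemma BB.add {f g : ℂ → ℂ} (hf : BB f) (hg : BB g) : BB (fun z => f z + g z) := by
  obtain ⟨d1, C1, h1⟩ := hf
  obtain ⟨d2, C2, h2⟩ := hg
  exact ⟨d1.add d2, C1 + C2, fun z hz => (norm_add_le _ _).trans (add_le_add (h1 z hz) (h2 z hz))⟩

lemma BB.mul {f g : ℂ → ℂ} (hf : BB f) (hg : BB g) : BB (fun z => f z * g z) := by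
  obtain ⟨d1, C1, h1⟩ := hf
  obtain ⟨d2, C2, h2⟩ := hg
  refine ⟨d1.mul d2, C1 * C2, fun z hz => ?_⟩
  rw [norm_mul]
  exact mul_le_mul (h1 z hz) (h2 z hz) (norm_nonneg _) ((norm_nonneg _).trans (h1 z hz))

lemma BB.inv {p : ℂ} (hp : p.im < 0) : BB (fun z => (z - p)⁻¹) := by
  refine ⟨?_, (-p.im)⁻¹, fun z hz => ?_⟩
  · intro z hz
    exact ((differentiableAt_id.sub_const p).inv (sub_ne hp hz)).differentiableWithinAt
  · have hz' : 0 ≤ z.im := hz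
    rw [norm_inv]
    apply inv_anti₀ (by linarith)
    have := Complex.abs_im_le_norm (z - p)
    have h2 := le_abs_self (z - p).im
    simp at this h2
    linarith

lemma BB.w : BB (fun z => (z + I)⁻¹) := by
  have := BB.inv (p := -I) (by simp)
  simpa using this

lemma w_ne {z : ℂ} (hz : z ∈ UH) : z + I ≠ 0 := by
  have := sub_ne (p := -I) (by simp) hz
  simpa using this

lemma EO.bb {c : ℂ} {f : ℂ → ℂ} (h : EO c f) : ∃ g, BB g ∧ ∀ z ∈ UH, f z = g z := by
  obtain ⟨r, hr, h⟩ := h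
  exact ⟨_, (BB.const c).add (BB.w.mul hr), h⟩

lemma EO.const (c : ℂ) : EO c (fun _ => c) := ⟨fun _ => 0, BB.const 0, by simp⟩

lemma EO.add {c d : ℂ} {f g : ℂ → ℂ} (hf : EO c f) (hg : EO d g) :
    EO (c + d) (fun z => f z + g z) := by
  obtain ⟨r, hr, h1⟩ := hf
  obtain ⟨s, hs, h2⟩ := hg
  refine ⟨_, hr.add hs, fun z hz => ?_⟩
  simp only [h1 z hz, h2 z hz]
  ring

lemma EO.mul {c d : ℂ} {f g : ℂ → ℂ} (hf : EO c f) (hg : EO d g) :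
    EO (c * d) (fun z => f z * g z) := by
  obtain ⟨r, hr, h1⟩ := hf
  obtain ⟨s, hs, h2⟩ := hg
  refine ⟨_, (((BB.const c).mul hs).add ((BB.const d).mul hr)).add (BB.w.mul (hr.mul hs)),
    fun z hz => ?_⟩
  simp only [h1 z hz, h2 z hz]
  ring

lemma EO.pow {f : ℂ → ℂ} {c : ℂ} (hf : EO c f) (n : ℕ) : EO (c ^ n) (fun z => f z ^ n) := by
  induction n with
  | zero => simpa using EO.const 1
  | succ n ih => simpa only [pow_succ] using ih.mul hf

lemma EO.prod {ι : Type*} (s : Finset ι) (c : ι → ℂ) (f : ι → ℂ → ℂ) (h : ∀ i, EO (c i) (f i)) :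
    EO (∏ i ∈ s, c i) (fun z => ∏ i ∈ s, f i z) := by
  classical
  induction s using Finset.induction_on with
  | empty => simpa using EO.const 1
  | insert a s ha ih => simpa only [Finset.prod_insert ha] using (h a).mul ih

lemma EE.inv {p : ℂ} (hp : p.im < 0) : EE 1 (fun z => (z - p)⁻¹) := by
  refine ⟨fun z => (z + I) * (z - p)⁻¹,
    ⟨fun z => (I + p) * (1 + (I + p) * (z - p)⁻¹), ?_, ?_⟩, ?_⟩
  · exact (BB.const _).mul ((BB.const _).add ((BB.const _).mul (BB.inv hp)))
  · intro z hz
    have := sub_ne hp hz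
    have := w_ne hz
    field_simp
    ring
  · intro z hz
    have := w_ne hz
    field_simp

lemma EE.eo {c : ℂ} {f : ℂ → ℂ} (h : EE c f) : EO 0 f := by
  obtain ⟨e, he, h⟩ := h
  obtain ⟨g, hg, h2⟩ := he.bb
  refine ⟨g, hg, fun z hz => ?_⟩
  rw [h z hz, h2 z hz, zero_add]

lemma EE.mul {c d : ℂ} {f g : ℂ → ℂ} (hf : EE c f) (hg : EO d g) :
    EE (c * d) (fun z => f z * g z) := by
  obtain ⟨r, hr, h1⟩ := hf
  refine ⟨_, hr.mul hg, fun z hz => ?_⟩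
  simp only [h1 z hz]
  ring

lemma EE.add {c d : ℂ} {f g : ℂ → ℂ} (hf : EE c f) (hg : EE d g) :
    EE (c + d) (fun z => f z + g z) := by
  obtain ⟨r, hr, h1⟩ := hf
  obtain ⟨s, hs, h2⟩ := hg
  refine ⟨_, hr.add hs, fun z hz => ?_⟩
  simp only [h1 z hz, h2 z hz]
  ring

lemma EE.sum {ι : Type*} (s : Finset ι) (f : ι → ℂ → ℂ) (h : ∀ i, ∃ c, EE c (f i)) :
    ∃ c, EE c (fun z => ∑ i ∈ s, f i z) := by
  classical
  induction s using Finset.induction_on with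
  | empty => exact ⟨0, fun _ => 0, EO.const 0, by simp⟩
  | insert a s ha ih =>
    obtain ⟨c, hc⟩ := h a
    obtain ⟨d, hd⟩ := ih
    exact ⟨c + d, by simpa only [Finset.sum_insert ha] using hc.add hd⟩

lemma EO.blaschke {p : ℂ} (hp : p.im < 0) :
    EO 1 (fun z => (z - (starRingEnd ℂ) p) / (z - p)) := by
  have h := (EO.const 1).add ((EO.const (p - (starRingEnd ℂ) p)).mul (EE.inv hp).eo)
  simp only [mul_zero, add_zero] at h
  obtain ⟨r, hr, h⟩ := h
  refine ⟨r, hr, fun z hz => ?_⟩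
  rw [← h z hz]
  have := sub_ne hp hz
  field_simp
  ring

lemma real_mem (x : ℝ) : (x : ℂ) ∈ UH := by simp [UH]

lemma tendsto_w : Tendsto (fun x : ℝ => ((x : ℂ) + I)⁻¹) atTop (nhds 0) := by
  rw [tendsto_zero_iff_norm_tendsto_zero]
  refine squeeze_zero' (Eventually.of_forall fun _ => norm_nonneg _) ?_ tendsto_inv_atTop_zero
  filter_upwards [eventually_gt_atTop 0] with x hx
  rw [norm_inv]
  apply inv_anti₀ hx
  have := Complex.abs_re_le_norm ((x : ℂ) + I)
  have h2 := le_abs_self ((x : ℂ) + I).re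
  simp at this h2
  linarith

lemma EO.tendsto {c : ℂ} {f : ℂ → ℂ} (h : EO c f) :
    Tendsto (fun x : ℝ => f x) atTop (nhds c) := by
  obtain ⟨r, ⟨_, C, hC⟩, h⟩ := h
  have h0 : Tendsto (fun x : ℝ => ((x : ℂ) + I)⁻¹ * r x) atTop (nhds 0) := by
    rw [tendsto_zero_iff_norm_tendsto_zero]
    have := (tendsto_zero_iff_norm_tendsto_zero.1 tendsto_w).mul_const C
    rw [zero_mul] at this
    refine squeeze_zero (fun _ => norm_nonneg _) (fun x => ?_) this
    rw [norm_mul]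
    exact mul_le_mul_of_nonneg_left (hC _ (real_mem x)) (norm_nonneg _)
  have := h0.const_add c
  rw [add_zero] at this
  exact this.congr fun x => (h _ (real_mem x)).symm

lemma EE.tendsto {c : ℂ} {f : ℂ → ℂ} (h : EE c f) :
    Tendsto (fun x : ℝ => (x : ℂ) * f x) atTop (nhds c) := by
  obtain ⟨e, he, h⟩ := h
  have h1 : Tendsto (fun x : ℝ => 1 - I * ((x : ℂ) + I)⁻¹) atTop (nhds 1) := by
    simpa using (tendsto_w.const_mul I).const_sub 1
  have := h1.mul he.tendsto
  rw [one_mul] at this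
  refine this.congr fun x => ?_
  rw [h _ (real_mem x)]
  have := w_ne (real_mem x)
  field_simp
  ring

lemma norm_w_le {z : ℂ} (hz : z ∈ UH) {R : ℝ} (hR : 0 < R) (h : R ≤ |z.re| ∨ R ≤ z.im) :
    ‖(z + I)⁻¹‖ ≤ R⁻¹ := by
  rw [norm_inv]
  apply inv_anti₀ hR
  rcases h with h | h
  · refine h.trans ?_
    simpa using Complex.abs_re_le_norm (z + I)
  · have h1 := Complex.abs_im_le_norm (z + I)
    have h2 := le_abs_self (z + I).im
    simp at h1 h2
    linarith

lemma norm_ww_le {r : ℂ → ℂ} {C : ℝ} (hC : ∀ z ∈ UH, ‖r z‖ ≤ C) {z : ℂ} (hz : z ∈ UH) {R : ℝ}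
    (hR : 0 < R) (h : R ≤ |z.re| ∨ R ≤ z.im) :
    ‖(z + I)⁻¹ * ((z + I)⁻¹ * r z)‖ ≤ R⁻¹ * (R⁻¹ * C) := by
  have h1 := norm_w_le hz hR h
  rw [norm_mul, norm_mul]
  have := hC z hz
  gcongr

lemma integrable_ww {r : ℂ → ℂ} (hr : BB r) :
    Integrable (fun x : ℝ => ((x : ℂ) + I)⁻¹ * (((x : ℂ) + I)⁻¹ * r x)) := by
  have hd := (BB.w.mul (BB.w.mul hr)).1
  obtain ⟨_, C, hC⟩ := hr
  have hcont : Continuous (fun x : ℝ => ((x : ℂ) + I)⁻¹ * (((x : ℂ) + I)⁻¹ * r x)) :=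
    hd.continuousOn.comp_continuous continuous_ofReal real_mem
  refine (integrable_inv_one_add_sq.mul_const C).mono' hcont.aestronglyMeasurable
    (Eventually.of_forall fun x => ?_)
  have h1 : ‖(x : ℂ) + I‖ ^ 2 = 1 + x ^ 2 := by
    rw [← Complex.normSq_eq_norm_sq, Complex.normSq_apply]; simp; ring
  rw [norm_mul, norm_mul, norm_inv, ← h1, ← mul_assoc, sq, mul_inv]
  exact mul_le_mul_of_nonneg_left (hC _ (real_mem x)) (by positivity)

lemma integral_ww {r : ℂ → ℂ} (hr : BB r) :
    ∫ x : ℝ, ((x : ℂ) + I)⁻¹ * (((x : ℂ) + I)⁻¹ * r x) = 0 := by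
  have hi := integrable_ww hr
  have hd := (BB.w.mul (BB.w.mul hr)).1
  obtain ⟨_, C, hC⟩ := hr
  have hlim := intervalIntegral_tendsto_integral hi tendsto_neg_atTop_atBot tendsto_id
  refine tendsto_nhds_unique hlim ?_
  rw [tendsto_zero_iff_norm_tendsto_zero]
  have h4 : Tendsto (fun R : ℝ => 4 * C * R⁻¹) atTop (nhds 0) := by
    simpa using tendsto_inv_atTop_zero.const_mul (4 * C)
  refine squeeze_zero' (Eventually.of_forall fun _ => norm_nonneg _) ?_ h4
  filter_upwards [eventually_gt_atTop 0] with R hR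
  set f : ℂ → ℂ := fun z => (z + I)⁻¹ * ((z + I)⁻¹ * r z) with hf
  have hrect := Complex.integral_boundary_rect_eq_zero_of_differentiableOn f
    (-R : ℂ) (R + R * I) (hd.mono (by
      intro z hz
      have h2 := hz.2
      simp [Set.uIcc_of_le hR.le] at h2
      exact h2.1))
  simp at hrect
  have b1 : ‖∫ x in (-R)..R, f (x + R * I)‖ ≤ R⁻¹ * (R⁻¹ * C) * |R - (-R)| := by
    apply intervalIntegral.norm_integral_le_of_norm_le_const
    intro x hx
    exact norm_ww_le hC (by simp [UH, hR.le]) hR (Or.inr (by simp))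
  have b2 : ‖∫ y in (0 : ℝ)..R, f (R + y * I)‖ ≤ R⁻¹ * (R⁻¹ * C) * |R - 0| := by
    apply intervalIntegral.norm_integral_le_of_norm_le_const
    intro x hx
    rw [Set.uIoc_of_le hR.le] at hx
    exact norm_ww_le hC (by simp [UH, hx.1.le]) hR (Or.inl (by simp [le_abs_self]))
  have b3 : ‖∫ y in (0 : ℝ)..R, f (-R + y * I)‖ ≤ R⁻¹ * (R⁻¹ * C) * |R - 0| := by
    apply intervalIntegral.norm_integral_le_of_norm_le_const
    intro x hx
    rw [Set.uIoc_of_le hR.le] at hx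
    exact norm_ww_le hC (by simp [UH, hx.1.le]) hR (Or.inl (by simp [le_abs_self]))
  have key : ∫ x in (-R)..R, f x = (∫ x in (-R)..R, f (x + R * I))
      - I * (∫ y in (0 : ℝ)..R, f (R + y * I)) + I * ∫ y in (0 : ℝ)..R, f (-R + y * I) := by
    linear_combination hrect
  change ‖∫ x in (-R)..R, f x‖ ≤ _
  rw [key]
  refine (norm_add_le _ _).trans ((add_le_add_left (norm_sub_le _ _) _).trans ?_)
  rw [norm_mul, norm_mul, norm_I, one_mul, one_mul]
  rw [show R - -R = 2 * R by ring, abs_of_pos (by linarith : 0 < 2 * R)] at b1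
  rw [sub_zero, abs_of_pos hR] at b2 b3
  have e1 : R⁻¹ * (R⁻¹ * C) * (2 * R) = 2 * C * R⁻¹ := by field_simp
  have e2 : R⁻¹ * (R⁻¹ * C) * R = C * R⁻¹ := by field_simp
  rw [e1] at b1
  rw [e2] at b2 b3
  linarith

lemma EE_pow {p : ℂ} (hp : p.im < 0) (a : ℂ) (l : ℕ) :
    ∃ c, EE c (fun z => a / (z - p) ^ (l + 1)) := by
  refine ⟨_, by
    have := (EE.inv hp).mul (((EE.inv hp).eo.pow l).mul (EO.const a))
    convert this using 2 with z
    rw [div_eq_mul_inv, pow_succ, mul_inv, inv_pow]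
    ring⟩

/-- **Adjoint of the infinitesimal shift operator.**  On `Ran H_u = span{1/(x-p_j)^l}`
(poles `p_j` in the lower half-plane, multiplicities `m_j`), with
`T g = x g - Λ(g) b_u` and `Λ(g) = lim_{x→∞} x g(x)`, the adjoint of `T` for the `L²`
inner product is `T* g = x g - Λ(g)`: for all `g₁, g₂ ∈ Ran H_u`,
`(T g₁, g₂) = (g₁, x g₂ - Λ(g₂))`. -/
theorem stmt_14 (k : ℕ) (p : Fin k → ℂ) (hp : ∀ j, (p j).im < 0) (m : Fin k → ℕ)
    (bu : ℝ → ℂ)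
    (hbu : ∀ x : ℝ, bu x = ∏ j, (((x : ℂ) - (starRingEnd ℂ) (p j)) / ((x : ℂ) - p j)) ^ (m j))
    (a₁ a₂ : (j : Fin k) → Fin (m j) → ℂ) (g₁ g₂ : ℝ → ℂ)
    (hg₁ : ∀ x : ℝ, g₁ x = ∑ j, ∑ l, a₁ j l / ((x : ℂ) - p j) ^ ((l : ℕ) + 1))
    (hg₂ : ∀ x : ℝ, g₂ x = ∑ j, ∑ l, a₂ j l / ((x : ℂ) - p j) ^ ((l : ℕ) + 1))
    (Λ₁ Λ₂ : ℂ)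
    (hΛ₁ : Tendsto (fun x : ℝ => (x : ℂ) * g₁ x) atTop (nhds Λ₁))
    (hΛ₂ : Tendsto (fun x : ℝ => (x : ℂ) * g₂ x) atTop (nhds Λ₂)) :
    ∫ x : ℝ, ((x : ℂ) * g₁ x - Λ₁ * bu x) * (starRingEnd ℂ) (g₂ x)
      = ∫ x : ℝ, g₁ x * (starRingEnd ℂ) ((x : ℂ) * g₂ x - Λ₂) := by
  classical
  -- extension of g₁
  obtain ⟨c₁, hG₁⟩ := EE.sum Finset.univ
    (fun j (z : ℂ) => ∑ l, a₁ j l / (z - p j) ^ ((l : ℕ) + 1))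
    (fun j => EE.sum Finset.univ _ (fun l => EE_pow (hp j) _ _))
  have hb := EO.prod Finset.univ _ _ (fun j => (EO.blaschke (hp j)).pow (m j))
  simp only [one_pow, Finset.prod_const_one] at hb
  obtain ⟨c₂, hG₂⟩ := EE.sum Finset.univ
    (fun j (z : ℂ) => ∑ l : Fin (m j), ((starRingEnd ℂ) (a₂ j l) / (z - p j) ^ ((l : ℕ) + 1)) *
      (((z - (starRingEnd ℂ) (p j)) / (z - p j)) ^ (m j - (l + 1)) *
       ∏ i ∈ Finset.univ.erase j, ((z - (starRingEnd ℂ) (p i)) / (z - p i)) ^ (m i)))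
    (fun j => EE.sum Finset.univ _ (fun l => by
      obtain ⟨c, hc⟩ := EE_pow (hp j) ((starRingEnd ℂ) (a₂ j l)) l
      exact ⟨_, hc.mul (((EO.blaschke (hp j)).pow _).mul
        (EO.prod _ _ _ (fun i => (EO.blaschke (hp i)).pow (m i))))⟩))
  set G₁ := fun z : ℂ => ∑ j, ∑ l, a₁ j l / (z - p j) ^ ((l : ℕ) + 1) with hG₁d
  set G₂ := fun z : ℂ => ∑ j, ∑ l : Fin (m j),
    ((starRingEnd ℂ) (a₂ j l) / (z - p j) ^ ((l : ℕ) + 1)) *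
      (((z - (starRingEnd ℂ) (p j)) / (z - p j)) ^ (m j - (l + 1)) *
       ∏ i ∈ Finset.univ.erase j, ((z - (starRingEnd ℂ) (p i)) / (z - p i)) ^ (m i)) with hG₂d
  have e₁ : ∀ x : ℝ, g₁ x = G₁ x := hg₁
  have e₂ : ∀ x : ℝ, bu x * (starRingEnd ℂ) (g₂ x) = G₂ x := by
    intro x
    rw [hbu, hg₂, hG₂d, map_sum, Finset.mul_sum]
    refine Finset.sum_congr rfl fun j _ => ?_
    rw [map_sum, Finset.mul_sum]
    refine Finset.sum_congr rfl fun l _ => ?_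
    rw [← Finset.mul_prod_erase Finset.univ _ (Finset.mem_univ j)]
    simp only [map_div₀, map_pow, map_sub, conj_ofReal]
    have n1 : (x : ℂ) - p j ≠ 0 := sub_ne (hp j) (real_mem x)
    have n2 : (x : ℂ) - (starRingEnd ℂ) (p j) ≠ 0 := by
      intro h
      apply n1
      have := congrArg (starRingEnd ℂ) h
      simpa using this
    have hm : ((x : ℂ) - (starRingEnd ℂ) (p j)) ^ (m j)
        = (x - (starRingEnd ℂ) (p j)) ^ (m j - (l + 1)) * (x - (starRingEnd ℂ) (p j)) ^ ((l : ℕ) + 1) := by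
      rw [← pow_add]; congr 1; have := l.2; omega
    have hm' : ((x : ℂ) - p j) ^ (m j)
        = (x - p j) ^ (m j - (l + 1)) * (x - p j) ^ ((l : ℕ) + 1) := by
      rw [← pow_add]; congr 1; have := l.2; omega
    generalize ∏ i ∈ Finset.univ.erase j,
      (((x : ℂ) - (starRingEnd ℂ) (p i)) / ((x : ℂ) - p i)) ^ (m i) = P
    rw [div_pow, div_pow, hm, hm']
    have q1 := pow_ne_zero ((l : ℕ) + 1) n1
    have q2 := pow_ne_zero ((l : ℕ) + 1) n2
    have q3 := pow_ne_zero (m j - ((l : ℕ) + 1)) n1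
    generalize ((x : ℂ) - p j) ^ ((l : ℕ) + 1) = A at *
    generalize ((x : ℂ) - (starRingEnd ℂ) (p j)) ^ ((l : ℕ) + 1) = B at *
    generalize ((x : ℂ) - p j) ^ (m j - ((l : ℕ) + 1)) = D at *
    field_simp
  have k₁ : c₁ = Λ₁ := tendsto_nhds_unique hG₁.tendsto (hΛ₁.congr fun x => by rw [e₁])
  have hbt : Tendsto bu atTop (nhds 1) := hb.tendsto.congr fun x => (hbu x).symm
  have k₂ : c₂ = (starRingEnd ℂ) Λ₂ := by
    refine tendsto_nhds_unique hG₂.tendsto ?_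
    have := hbt.mul ((continuous_conj.tendsto _).comp hΛ₂)
    rw [one_mul] at this
    refine this.congr fun x => ?_
    simp only [Function.comp, ← e₂, map_mul, conj_ofReal]
    ring
  have hh := (hG₁.mul (EO.const ((starRingEnd ℂ) Λ₂))).add (hG₂.mul (EO.const (-Λ₁)))
  rw [k₁, k₂, show Λ₁ * (starRingEnd ℂ) Λ₂ + (starRingEnd ℂ) Λ₂ * -Λ₁ = 0 by ring] at hh
  obtain ⟨e, ⟨r, hr, he⟩, hh⟩ := hh
  set h : ℝ → ℂ := fun x => ((x : ℂ) + I)⁻¹ * (((x : ℂ) + I)⁻¹ * r x) with hhd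
  have hint : Integrable h := integrable_ww hr
  have hzero : ∫ x, h x = 0 := integral_ww hr
  have heq : ∀ x : ℝ, ((x : ℂ) * g₁ x - Λ₁ * bu x) * (starRingEnd ℂ) (g₂ x)
      = g₁ x * (starRingEnd ℂ) ((x : ℂ) * g₂ x - Λ₂) + h x := by
    intro x
    have h1 := hh _ (real_mem x)
    beta_reduce at h1
    rw [he _ (real_mem x), zero_add, ← e₁, ← e₂] at h1
    simp only [hhd]
    rw [← h1]
    simp only [map_sub, map_mul, conj_ofReal]
    ring
  simp only [heq]
  by_cases hF : Integrable (fun x : ℝ => g₁ x * (starRingEnd ℂ) ((x : ℂ) * g₂ x - Λ₂))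
  · rw [integral_add hF hint, hzero, add_zero]
  · rw [integral_undef hF, integral_undef]
    intro hs
    apply hF
    refine (hs.sub hint).congr (Eventually.of_forall fun x => ?_)
    simp only [Pi.sub_apply, add_sub_cancel_right]
end
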